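/- arXiv:1612.04025 — 3 statements merged into one kernel-verified Lean document; each statement's English description precedes it below -/
import Mathlib

section
/- Let m, p be positive integers with p ≤ m, let X be a real m×p matrix of full column rank p, let D_1,…,D_m > 0, and for A ≥ 0 let V be the m×m diagonal matrix with entries A + D_i, P = V⁻¹ − V⁻¹X(X'V⁻¹X)⁻¹X'V⁻¹, and L_RE(A|y) = det(X'V⁻¹X)^{−1/2}·det(V)^{−1/2}·exp(−y'Py/2). Then for every y ∈ ℝ^m and every A ≥ 0, L_RE(A|y) ≤ det(X'X)^{−1/2}·(A + max_i D_i)^{p/2}·(A + min_i D_i)^{−m/2}. -/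
namespace Matrix

variable {m n : Type*} [Fintype n]

lemma mulVec_injective_of_rank_eq_card {X : Matrix m n ℝ} (hX : X.rank = Fintype.card n) :
    Function.Injective X.mulVec := by
  rw [mulVec_injective_iff, linearIndependent_iff_card_eq_finrank_span, ← hX,
    rank_eq_finrank_span_cols]
  rfl

variable [Fintype m] [DecidableEq n]

lemma PosSemidef.one_le_det_one_add {N : Matrix n n ℝ} (hN : N.PosSemidef) :
    1 ≤ (1 + N).det := by
  have hH : (1 + N).IsHermitian := isHermitian_one.add hN.1
  rw [hH.det_eq_prod_eigenvalues]
  refine Finset.one_le_prod fun i _ => ?_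
  have h1 := hH.mulVec_eigenvectorBasis i
  set v : n → ℝ := ⇑(hH.eigenvectorBasis i) with hv
  have hnonneg := hN.dotProduct_mulVec_nonneg v
  have hpos : 0 < v ⬝ᵥ v := by
    have h0 : v ≠ 0 := by
      intro h
      apply hH.eigenvectorBasis.orthonormal.ne_zero i
      ext j
      exact congrFun h j
    simpa using (dotProduct_star_self_pos_iff (v := v)).2 h0
  have h2 : v ⬝ᵥ ((1 + N) *ᵥ v) = hH.eigenvalues i * (v ⬝ᵥ v) := by
    rw [h1, dotProduct_smul, smul_eq_mul]
  rw [add_mulVec, one_mulVec, dotProduct_add] at h2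
  simp only [star_trivial] at hnonneg
  change 1 ≤ hH.eigenvalues i
  by_contra! hlt
  nlinarith

lemma PosDef.det_le_det_of_posSemidef_sub {S T : Matrix n n ℝ} (hS : S.PosDef)
    (hST : (T - S).PosSemidef) : S.det ≤ T.det := by
  obtain ⟨B, hB⟩ : ∃ B : Matrix n n ℝ, S = Bᴴ * B := by
    open scoped MatrixOrder in
    exact CStarAlgebra.nonneg_iff_eq_star_mul_self.mp hS.posSemidef.nonneg
  have hdet : S.det = B.det * B.det := by
    rw [hB, det_mul, det_conjTranspose, star_trivial]
  have hu : IsUnit B.det := by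
    refine isUnit_iff_ne_zero.2 fun h => hS.det_pos.ne' ?_
    rw [hdet, h, zero_mul]
  have huH : IsUnit Bᴴ.det := by rwa [det_conjTranspose, star_trivial]
  have hT : T = Bᴴ * (1 + B⁻¹ᴴ * (T - S) * B⁻¹) * B := by
    rw [mul_add, add_mul, mul_one, ← hB, conjTranspose_nonsing_inv, ← mul_assoc, ← mul_assoc,
      mul_nonsing_inv _ huH, one_mul, mul_assoc, nonsing_inv_mul _ hu, mul_one]
    abel
  have h1 := (hST.conjTranspose_mul_mul_same B⁻¹).one_le_det_one_add
  rw [hT, det_mul, det_mul, det_conjTranspose, star_trivial, hdet]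
  nlinarith [mul_self_nonneg B.det]

lemma PosDef.posSemidef_sub_mul_inv_mul [DecidableEq m] {W : Matrix m m ℝ}
    (hW : W.PosDef) {X : Matrix m n ℝ} (hM : (Xᵀ * W * X).PosDef) :
    (W - W * X * (Xᵀ * W * X)⁻¹ * Xᵀ * W).PosSemidef := by
  have hu : IsUnit (Xᵀ * W * X).det := hM.det_pos.ne'.isUnit
  have hWt : Wᵀ = W := hW.isHermitian
  have hMt : (Xᵀ * W * X)⁻¹ᵀ = (Xᵀ * W * X)⁻¹ := hM.inv.isHermitian
  set M := Xᵀ * W * X with hMdef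
  have hcancel : M⁻¹ * (Xᵀ * (W * (X * (M⁻¹ * (Xᵀ * W))))) = M⁻¹ * (Xᵀ * W) := by
    have : Xᵀ * (W * (X * (M⁻¹ * (Xᵀ * W)))) = M * M⁻¹ * (Xᵀ * W) := by
      simp only [hMdef, Matrix.mul_assoc]
    rw [this, mul_nonsing_inv _ hu, Matrix.one_mul]
  convert hW.posSemidef.conjTranspose_mul_mul_same (1 - X * M⁻¹ * Xᵀ * W) using 1
  simp only [conjTranspose_eq_transpose_of_trivial, transpose_sub, transpose_one, transpose_mul,
    transpose_transpose, hWt, hMt, Matrix.sub_mul, Matrix.mul_sub, Matrix.one_mul,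
    Matrix.mul_one, Matrix.mul_assoc, hcancel]
  abel

end Matrix

open Matrix

/-- Upper bound on the residual (REML) likelihood:
`L_RE(A|y) ≤ det(X'X)^{-1/2} (A + D_max)^{p/2} (A + D_min)^{-m/2}`. -/
theorem residual_likelihood_bound
    (m p : ℕ) (hm : 0 < m) (hp : 0 < p) (hpm : p ≤ m)
    (X : Matrix (Fin m) (Fin p) ℝ) (hX : X.rank = p)
    (D : Fin m → ℝ) (hD : ∀ j, 0 < D j)
    (Dmax Dmin : ℝ) (hDmax : IsGreatest (Set.range D) Dmax)
    (hDmin : IsLeast (Set.range D) Dmin)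
    (A : ℝ) (hA : 0 ≤ A)
    (V : Matrix (Fin m) (Fin m) ℝ)
    (hV : V = Matrix.diagonal (fun j => A + D j))
    (P : Matrix (Fin m) (Fin m) ℝ)
    (hP : P = V⁻¹ - V⁻¹ * X * (Xᵀ * V⁻¹ * X)⁻¹ * Xᵀ * V⁻¹)
    (y : Fin m → ℝ)
    (LRE : ℝ)
    (hLRE : LRE = (Xᵀ * V⁻¹ * X).det ^ (-(1:ℝ)/2) * V.det ^ (-(1:ℝ)/2) *
      Real.exp (-(y ⬝ᵥ P *ᵥ y) / 2)) :
    LRE ≤ (Xᵀ * X).det ^ (-(1:ℝ)/2) * (A + Dmax) ^ ((p:ℝ)/2) *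
      (A + Dmin) ^ (-(m:ℝ)/2) := by
  have hpos : ∀ j, 0 < A + D j := fun j => add_pos_of_nonneg_of_pos hA (hD j)
  have hle : ∀ j, D j ≤ Dmax := fun j => hDmax.2 ⟨j, rfl⟩
  have hge : ∀ j, Dmin ≤ D j := fun j => hDmin.2 ⟨j, rfl⟩
  have hmax : 0 < A + Dmax := by
    obtain ⟨j, rfl⟩ := hDmax.1
    exact hpos j
  have hmin : 0 < A + Dmin := by
    obtain ⟨j, rfl⟩ := hDmin.1
    exact hpos j
  have hXinj : Function.Injective X.mulVec :=
    mulVec_injective_of_rank_eq_card (by rw [hX, Fintype.card_fin])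
  have hXX : (Xᵀ * X).PosDef := by
    simpa using PosDef.conjTranspose_mul_self X hXinj
  have hVpd : V.PosDef := hV ▸ PosDef.diagonal hpos
  have hVinv : V⁻¹ = diagonal fun j => (A + D j)⁻¹ := by
    refine inv_eq_left_inv ?_
    rw [hV, diagonal_mul_diagonal, ← diagonal_one]
    congr 1
    funext j
    exact inv_mul_cancel₀ (hpos j).ne'
  have hM : (Xᵀ * V⁻¹ * X).PosDef := by
    simpa using hVpd.inv.conjTranspose_mul_mul_same hXinj
  have hPpsd : P.PosSemidef := hP ▸ hVpd.inv.posSemidef_sub_mul_inv_mul hM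
  have hexp : Real.exp (-(y ⬝ᵥ P *ᵥ y) / 2) ≤ 1 := by
    have := hPpsd.dotProduct_mulVec_nonneg y
    rw [star_trivial] at this
    exact Real.exp_le_one_iff.2 (by linarith)
  have hdetV : (A + Dmin) ^ m ≤ V.det := by
    rw [hV, det_diagonal]
    calc (A + Dmin) ^ m = ∏ _j : Fin m, (A + Dmin) := by simp
      _ ≤ ∏ j, (A + D j) :=
        Finset.prod_le_prod (fun _ _ => hmin.le) fun j _ => by linarith [hge j]
  have hdetM : (A + Dmax)⁻¹ ^ p * (Xᵀ * X).det ≤ (Xᵀ * V⁻¹ * X).det := by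
    have hsub : (V⁻¹ - (A + Dmax)⁻¹ • (1 : Matrix (Fin m) (Fin m) ℝ)).PosSemidef := by
      rw [hVinv, smul_one_eq_diagonal, diagonal_sub]
      refine PosSemidef.diagonal fun j => sub_nonneg.2 ?_
      exact inv_anti₀ (hpos j) (by linarith [hle j])
    have h := (hXX.smul (inv_pos.2 hmax)).det_le_det_of_posSemidef_sub
      (T := Xᵀ * V⁻¹ * X) (by
        simpa [Matrix.mul_sub, Matrix.sub_mul] using hsub.conjTranspose_mul_mul_same X)
    rwa [det_smul, Fintype.card_fin] at h
  have hVfac : V.det ^ (-(1:ℝ)/2) ≤ (A + Dmin) ^ (-(m:ℝ)/2) := by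
    refine (Real.rpow_le_rpow_of_nonpos (pow_pos hmin m) hdetV (by norm_num)).trans_eq ?_
    rw [← Real.rpow_natCast, ← Real.rpow_mul hmin.le]
    congr 1
    ring
  have hMfac : (Xᵀ * V⁻¹ * X).det ^ (-(1:ℝ)/2) ≤
      (Xᵀ * X).det ^ (-(1:ℝ)/2) * (A + Dmax) ^ ((p:ℝ)/2) := by
    have hc : 0 < (A + Dmax)⁻¹ ^ p := pow_pos (inv_pos.2 hmax) p
    refine (Real.rpow_le_rpow_of_nonpos (mul_pos hc hXX.det_pos) hdetM
      (by norm_num)).trans_eq ?_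
    rw [Real.mul_rpow hc.le hXX.det_pos.le, mul_comm, ← Real.rpow_natCast,
      ← Real.rpow_neg_one, ← Real.rpow_mul hmax.le, ← Real.rpow_mul hmax.le]
    congr 2
    ring
  have hVnonneg : 0 ≤ V.det ^ (-(1:ℝ)/2) := Real.rpow_nonneg hVpd.det_pos.le _
  have hMnonneg : 0 ≤ (Xᵀ * V⁻¹ * X).det ^ (-(1:ℝ)/2) := Real.rpow_nonneg hM.det_pos.le _
  rw [hLRE]
  exact (mul_le_of_le_one_right (mul_nonneg hMnonneg hVnonneg) hexp).trans
    (mul_le_mul hMfac hVfac hVnonneg (hMnonneg.trans hMfac))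
end

section
/- Let m, p be positive integers with m > p + 4, let X be a real m×p matrix of full column rank p, let D_1,…,D_m > 0, fix an index i and y ∈ ℝ^m, and for A ≥ 0 let L_RE(A|y) = det(X'V⁻¹X)^{−1/2} det(V)^{−1/2} exp(−y'Py/2), where V is the diagonal matrix with entries A + D_j and P = V⁻¹ − V⁻¹X(X'V⁻¹X)⁻¹X'V⁻¹. Let L̃_add : [0,∞) → ℝ be continuous with L̃_add(0) = 0, L̃_add(A) > 0 for A > 0, and L̃_add bounded above. Then the function f(A) = (A + D_i)²·L̃_add(A)·L_RE(A|y) attains its supremum over [0,∞) at some point Â_i^N ∈ (0,∞); that is, the adjusted maximum-likelihood estimator Â_i^N with adjustment factor L̃_i^N(A)·L̃_add(A) = C(A+D_i)²·L̃_add(A) is strictly positive whenever m > p + 4. (Theorem 2(iii).) -/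
open Matrix

open Filter Topology

namespace FayHerriot

variable {m p : ℕ} (X : Matrix (Fin m) (Fin p) ℝ) (y : Fin m → ℝ)

/-- The weighted Gram matrix `Xᵀ diag(v) X`. -/
def gram (v : Fin m → ℝ) : Matrix (Fin p) (Fin p) ℝ := Xᵀ * diagonal v * X

/-- The determinant factor of the residual likelihood, as a function of the precisions. -/
noncomputable def detFactor (v : Fin m → ℝ) : ℝ :=
  (gram X v).det ^ (-(1 : ℝ) / 2) * (∏ j, v j) ^ ((1 : ℝ) / 2)

/-- The residual quadratic form `yᵀ P y`, as a function of the precisions. -/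
noncomputable def residualForm (v : Fin m → ℝ) : ℝ :=
  y ⬝ᵥ (diagonal v - diagonal v * X * (gram X v)⁻¹ * Xᵀ * diagonal v) *ᵥ y

/-- The residual likelihood as a function of the precisions. -/
noncomputable def residualLikelihood (v : Fin m → ℝ) : ℝ :=
  detFactor X v * Real.exp (-residualForm X y v / 2)

variable {X}

lemma gram_det_pos (hX : X.rank = p) {v : Fin m → ℝ} (hv : ∀ j, 0 < v j) :
    0 < (gram X v).det := by
  have hinj : Function.Injective X.mulVec := by
    rw [Matrix.mulVec_injective_iff, linearIndependent_iff_card_eq_finrank_span,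
      Fintype.card_fin, Set.finrank, ← Matrix.rank_eq_finrank_span_cols, hX]
  have h := (Matrix.PosDef.diagonal hv).conjTranspose_mul_mul_same hinj
  rw [Matrix.conjTranspose_eq_transpose_of_trivial] at h
  exact h.det_pos

variable (X) in
lemma continuous_gram : Continuous (gram X) := by
  unfold gram
  fun_prop

lemma continuousAt_detFactor (hX : X.rank = p) {v : Fin m → ℝ} (hv : ∀ j, 0 < v j) :
    ContinuousAt (detFactor X) v := by
  have hprod : ContinuousAt (fun v : Fin m → ℝ => ∏ j, v j) v := by fun_prop
  exact ((continuous_gram X).matrix_det.continuousAt.rpow_const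
    (Or.inl (gram_det_pos hX hv).ne')).mul (hprod.rpow_const (Or.inr (by norm_num)))

lemma continuousAt_residualForm (hX : X.rank = p) {v : Fin m → ℝ} (hv : ∀ j, 0 < v j) :
    ContinuousAt (residualForm X y) v := by
  have hd : ContinuousAt (fun v : Fin m → ℝ => diagonal v) v :=
    (continuous_id.matrix_diagonal).continuousAt
  have hinv : ContinuousAt (fun v => (gram X v)⁻¹) v := by
    simp only [Matrix.inv_def, Ring.inverse_eq_inv']
    exact ((continuous_gram X).matrix_det.continuousAt.inv₀ (gram_det_pos hX hv).ne').smul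
      (continuous_gram X).matrix_adjugate.continuousAt
  have hP : ContinuousAt (fun v : Fin m → ℝ =>
      diagonal v - diagonal v * X * (gram X v)⁻¹ * Xᵀ * diagonal v) v := by
    fun_prop
  have hform : Continuous (fun B : Matrix (Fin m) (Fin m) ℝ => y ⬝ᵥ B *ᵥ y) := by fun_prop
  exact hform.continuousAt.comp hP

lemma continuousAt_residualLikelihood (hX : X.rank = p) {v : Fin m → ℝ} (hv : ∀ j, 0 < v j) :
    ContinuousAt (residualLikelihood X y) v :=
  (continuousAt_detFactor hX hv).mul
    ((continuousAt_residualForm y hX hv).neg.div_const 2).rexp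

lemma residualLikelihood_pos (hX : X.rank = p) {v : Fin m → ℝ} (hv : ∀ j, 0 < v j) :
    0 < residualLikelihood X y v :=
  mul_pos (mul_pos (Real.rpow_pos_of_pos (gram_det_pos hX hv) _)
    (Real.rpow_pos_of_pos (Finset.prod_pos fun j _ => hv j) _)) (Real.exp_pos _)

variable (X) in
lemma gram_smul (c : ℝ) (v : Fin m → ℝ) : gram X (c • v) = c • gram X v := by
  simp [gram, Matrix.diagonal_smul]

lemma detFactor_smul (hX : X.rank = p) {c : ℝ} (hc : 0 < c) {v : Fin m → ℝ}
    (hv : ∀ j, 0 < v j) :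
    detFactor X (c • v) = c ^ (((m : ℝ) - p) / 2) * detFactor X v := by
  have hdet := gram_det_pos hX hv
  have hprod : 0 < ∏ j, v j := Finset.prod_pos fun j _ => hv j
  have hexp : c ^ (((m : ℝ) - p) / 2) =
      (c ^ p) ^ (-(1 : ℝ) / 2) * (c ^ m) ^ ((1 : ℝ) / 2) := by
    rw [← Real.rpow_natCast c p, ← Real.rpow_natCast c m, ← Real.rpow_mul hc.le,
      ← Real.rpow_mul hc.le, ← Real.rpow_add hc]
    congr 1
    ring
  simp only [detFactor, gram_smul, Matrix.det_smul, Fintype.card_fin, Pi.smul_apply, smul_eq_mul,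
    Finset.prod_mul_distrib, Finset.prod_const, Finset.card_univ]
  rw [Real.mul_rpow (pow_pos hc _).le hdet.le, Real.mul_rpow (pow_pos hc _).le hprod.le, hexp]
  ring

lemma residualForm_smul {c : ℝ} (hc : c ≠ 0) (v : Fin m → ℝ) (hv : (gram X v).det ≠ 0) :
    residualForm X y (c • v) = c * residualForm X y v := by
  have hinv : (c • gram X v)⁻¹ = c⁻¹ • (gram X v)⁻¹ := by
    refine Matrix.inv_eq_left_inv ?_
    rw [Matrix.smul_mul, Matrix.mul_smul, smul_smul, inv_mul_cancel₀ hc, one_smul,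
      Matrix.nonsing_inv_mul _ (isUnit_iff_ne_zero.mpr hv)]
  rw [residualForm, residualForm, gram_smul, hinv, Matrix.diagonal_smul]
  simp only [Matrix.smul_mul, Matrix.mul_smul, smul_smul]
  rw [inv_mul_cancel₀ hc, mul_one, ← smul_sub, Matrix.smul_mulVec, dotProduct_smul, smul_eq_mul]

/-- Along `A → ∞` the residual likelihood decays faster than `(A + d)⁻²` when `m > p + 4`. -/
lemma tendsto_sq_mul_residualLikelihood (hmp : p + 4 < m) (hX : X.rank = p) {D : Fin m → ℝ}
    (hD : ∀ j, 0 < D j) (d : ℝ) :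
    Tendsto (fun A : ℝ => (A + d) ^ 2 * residualLikelihood X y (fun j => (A + D j)⁻¹))
      atTop (𝓝 0) := by
  let u : ℝ → Fin m → ℝ := fun c j => (1 + D j * c)⁻¹
  have hu : Tendsto (fun A : ℝ => u A⁻¹) atTop (𝓝 fun _ => 1) := by
    rw [tendsto_pi_nhds]
    intro j
    have h := ((tendsto_inv_atTop_zero (𝕜 := ℝ)).const_mul (D j)).const_add 1
    simpa using h.inv₀ (by simp)
  have hone : ∀ j : Fin m, (0 : ℝ) < (fun _ => 1 : Fin m → ℝ) j := fun _ => one_pos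
  have hK := (continuousAt_detFactor hX hone).tendsto.comp hu
  have hQ := (continuousAt_residualForm y hX hone).tendsto.comp hu
  have hE := ((tendsto_inv_atTop_zero (𝕜 := ℝ)).mul hQ).neg.div_const 2 |>.rexp
  have hexp : 0 < ((m : ℝ) - p) / 2 - 2 := by
    have : (p : ℝ) + 4 < m := by exact_mod_cast hmp
    linarith
  have hpow := tendsto_rpow_neg_atTop hexp
  have hsq := (((tendsto_inv_atTop_zero (𝕜 := ℝ)).const_mul d).const_add 1).pow 2
  have hlim := (hsq.mul hpow).mul (hK.mul hE)
  simp only [mul_zero, zero_mul] at hlim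
  refine hlim.congr' ?_
  filter_upwards [eventually_gt_atTop 0] with A hA
  have hupos : ∀ j, 0 < u A⁻¹ j := fun j =>
    inv_pos.mpr (add_pos one_pos (mul_pos (hD j) (inv_pos.mpr hA)))
  have hscale : (fun j => (A + D j)⁻¹) = A⁻¹ • u A⁻¹ := by
    funext j
    have := hD j
    simp only [u, Pi.smul_apply, smul_eq_mul]
    field_simp
  have hrpow : A⁻¹ ^ (((m : ℝ) - p) / 2) = A ^ (-(((m : ℝ) - p) / 2 - 2)) * A⁻¹ ^ 2 := by
    rw [Real.inv_rpow hA.le, ← Real.rpow_neg hA.le, inv_pow, ← Real.rpow_natCast A 2,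
      ← Real.rpow_neg hA.le, ← Real.rpow_add hA]
    congr 1
    push_cast
    ring
  rw [hscale, residualLikelihood, detFactor_smul hX (inv_pos.mpr hA) hupos,
    residualForm_smul y (inv_pos.mpr hA).ne' _ (gram_det_pos hX hupos).ne', hrpow]
  simp only [Function.comp_apply]
  field_simp

end FayHerriot

/-- Theorem 2(iii): the adjusted likelihood
`(A + Dᵢ)² L̃_add(A) L_RE(A|y)` attains its supremum over `[0,∞)` at a strictly
positive point whenever `m > p + 4`; i.e. the adjusted maximum-likelihood
estimator `Âᵢᴺ` is strictly positive. -/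
theorem naive_adjusted_ml_estimator_pos
    (m p : ℕ) (hm : 0 < m) (hp : 0 < p) (hmp : p + 4 < m)
    (X : Matrix (Fin m) (Fin p) ℝ) (hX : X.rank = p)
    (D : Fin m → ℝ) (hD : ∀ j, 0 < D j)
    (i : Fin m) (y : Fin m → ℝ)
    (V : ℝ → Matrix (Fin m) (Fin m) ℝ)
    (hV : ∀ A, V A = Matrix.diagonal (fun j => A + D j))
    (P : ℝ → Matrix (Fin m) (Fin m) ℝ)
    (hP : ∀ A, P A = (V A)⁻¹ - (V A)⁻¹ * X * (Xᵀ * (V A)⁻¹ * X)⁻¹ * Xᵀ * (V A)⁻¹)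
    (LRE : ℝ → ℝ)
    (hLRE : ∀ A, LRE A = (Xᵀ * (V A)⁻¹ * X).det ^ (-(1:ℝ)/2) *
      (V A).det ^ (-(1:ℝ)/2) * Real.exp (-(y ⬝ᵥ (P A) *ᵥ y) / 2))
    (Ladd : ℝ → ℝ)
    (hLaddCont : ContinuousOn Ladd (Set.Ici 0))
    (hLadd0 : Ladd 0 = 0)
    (hLaddPos : ∀ A > 0, 0 < Ladd A)
    (hLaddBdd : ∃ M : ℝ, ∀ A ≥ 0, Ladd A ≤ M)
    (f : ℝ → ℝ)
    (hf : ∀ A, f A = (A + D i) ^ 2 * Ladd A * LRE A) :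
    ∃ AhatN > 0, ∀ A ≥ 0, f A ≤ f AhatN := by
  have hL : ∀ A ≥ 0, LRE A = FayHerriot.residualLikelihood X y (fun j => (A + D j)⁻¹) := by
    intro A hA
    have hpos : ∀ j, 0 < A + D j := fun j => add_pos_of_nonneg_of_pos hA (hD j)
    have hVinv : (V A)⁻¹ = Matrix.diagonal (fun j => (A + D j)⁻¹) := by
      rw [hV]
      refine Matrix.inv_eq_left_inv ?_
      rw [Matrix.diagonal_mul_diagonal, ← Matrix.diagonal_one]
      congr 1
      funext j
      exact inv_mul_cancel₀ (hpos j).ne'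
    have hprod : 0 < ∏ j, (A + D j) := Finset.prod_pos fun j _ => hpos j
    rw [hLRE, hP, hVinv, hV, Matrix.det_diagonal, FayHerriot.residualLikelihood,
      FayHerriot.detFactor, FayHerriot.residualForm, FayHerriot.gram, Finset.prod_inv_distrib,
      Real.inv_rpow hprod.le, ← Real.rpow_neg hprod.le, neg_div]
  have hprec : ∀ A ≥ 0, ∀ j, 0 < (A + D j)⁻¹ := fun A hA j =>
    inv_pos.mpr (add_pos_of_nonneg_of_pos hA (hD j))
  have hLpos : ∀ A ≥ 0, 0 < LRE A := fun A hA => by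
    rw [hL A hA]
    exact FayHerriot.residualLikelihood_pos y hX (hprec A hA)
  have hLcont : ContinuousOn LRE (Set.Ici 0) := by
    refine ContinuousOn.congr (fun A hA => ContinuousAt.continuousWithinAt ?_) hL
    refine ContinuousAt.comp (f := fun A : ℝ => fun j => (A + D j)⁻¹)
      (FayHerriot.continuousAt_residualLikelihood y hX (hprec A hA)) ?_
    exact continuousAt_pi.mpr fun j => (by fun_prop : ContinuousAt (fun A => A + D j) A).inv₀
      (inv_pos.mp (hprec A hA j)).ne'
  have hfcont : ContinuousOn f (Set.Ici 0) := by
    rw [funext hf]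
    fun_prop
  have hf0 : f 0 = 0 := by rw [hf, hLadd0]; ring
  have hfpos : 0 < f 1 := by
    rw [hf]
    exact mul_pos (mul_pos (pow_pos (add_pos one_pos (hD i)) 2) (hLaddPos 1 one_pos))
      (hLpos 1 zero_le_one)
  obtain ⟨M, hM⟩ := hLaddBdd
  have hbound := (FayHerriot.tendsto_sq_mul_residualLikelihood y hmp hX hD (D i)).const_mul M
  rw [mul_zero] at hbound
  obtain ⟨R, hR⟩ := eventually_atTop.mp (hbound.eventually (gt_mem_nhds hfpos))
  obtain ⟨A₀, hA₀, hmax⟩ := isCompact_Icc.exists_isMaxOn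
    (Set.nonempty_Icc.mpr (zero_le_one.trans (le_max_right R 1)))
    (hfcont.mono (fun A (hA : A ∈ Set.Icc 0 (max R 1)) => hA.1))
  have hone : f 1 ≤ f A₀ := hmax ⟨zero_le_one, le_max_right R 1⟩
  refine ⟨A₀, lt_of_le_of_ne hA₀.1 ?_, fun A hA => ?_⟩
  · rintro rfl
    linarith
  · rcases le_total A (max R 1) with h | h
    · exact hmax ⟨hA, h⟩
    · refine le_trans (le_trans ?_ (hR A ((le_max_left R 1).trans h)).le) hone
      rw [hf, ← hL A hA]
      calc (A + D i) ^ 2 * Ladd A * LRE A = Ladd A * ((A + D i) ^ 2 * LRE A) := by ring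
        _ ≤ M * ((A + D i) ^ 2 * LRE A) :=
          mul_le_mul_of_nonneg_right (hM A hA) (mul_nonneg (sq_nonneg _) (hLpos A hA).le)
end

section
/- Let m be a positive integer and D_1,…,D_m > 0, and define s(A) = Σ_{i=1}^m A/(A + D_i) for A > 0. Then the function A ↦ log(arctan(s(A))) is strictly increasing and concave on (0,∞). (Hence the Yoshimori–Lahiri adjustment factor L̃_add(A) = (arctan s(A))^{1/m} has strictly increasing concave logarithm, as required by Condition A3.) -/
/-- Composition of a concave function with a monotone concave function. Unlike `ConcaveOn.comp`,
the outer function need only be concave on a set containing the image. -/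
theorem ConcaveOn.comp_of_mapsTo {f g : ℝ → ℝ} {s t : Set ℝ} (hg : ConcaveOn ℝ t g)
    (hf : ConcaveOn ℝ s f) (hg' : MonotoneOn g t) (hst : Set.MapsTo f s t) :
    ConcaveOn ℝ s (fun x => g (f x)) :=
  ⟨hf.1, fun _ hx _ hy _ _ ha hb hab =>
    (hg.2 (hst hx) (hst hy) ha hb hab).trans <|
      hg' (hg.1 (hst hx) (hst hy) ha hb hab) (hst (hf.1 hx hy ha hb hab))
        (hf.2 hx hy ha hb hab)⟩

theorem concaveOn_finset_sum {ι : Type*} (u : Finset ι) {s : Set ℝ} {f : ι → ℝ → ℝ}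
    (hs : Convex ℝ s) (hf : ∀ i ∈ u, ConcaveOn ℝ s (f i)) :
    ConcaveOn ℝ s (fun x => ∑ i ∈ u, f i x) := by
  refine ⟨hs, fun x hx y hy a b ha hb hab => ?_⟩
  simp only [Finset.smul_sum, ← Finset.sum_add_distrib]
  exact Finset.sum_le_sum fun i hi => (hf i hi).2 hx hy ha hb hab

theorem concaveOn_arctan : ConcaveOn ℝ (Set.Ici 0) Real.arctan := by
  refine AntitoneOn.concaveOn_of_deriv (convex_Ici 0) Real.continuous_arctan.continuousOn
    Real.differentiable_arctan.differentiableOn ?_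
  rw [interior_Ici, Real.deriv_arctan]
  intro x hx y _ hxy
  have hx' : 0 < x := hx
  dsimp only
  gcongr

theorem div_add_const_eq_one_sub {d x : ℝ} (hd : 0 < d) (hx : 0 < x) :
    x / (x + d) = 1 - d / (x + d) := by
  field_simp
  ring

theorem strictMonoOn_div_add_const {d : ℝ} (hd : 0 < d) :
    StrictMonoOn (fun x : ℝ => x / (x + d)) (Set.Ioi 0) := by
  intro x hx y hy hxy
  have hx' : 0 < x := hx
  dsimp only
  rw [div_add_const_eq_one_sub hd hx, div_add_const_eq_one_sub hd hy]
  gcongr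

theorem concaveOn_div_add_const {d : ℝ} (hd : 0 < d) :
    ConcaveOn ℝ (Set.Ioi 0) (fun x : ℝ => x / (x + d)) := by
  have hderiv : ∀ x ∈ Set.Ioi (0 : ℝ),
      HasDerivAt (fun x : ℝ => x / (x + d)) (d / (x + d) ^ 2) x := by
    intro x hx
    have hx' : 0 < x := hx
    have h := (hasDerivAt_id' x).fun_div ((hasDerivAt_id' x).add_const d) (by positivity)
    rwa [one_mul, mul_one, add_sub_cancel_left] at h
  refine AntitoneOn.concaveOn_of_deriv (convex_Ioi 0)
    (fun x hx => (hderiv x hx).continuousAt.continuousWithinAt) ?_ ?_ <;> rw [interior_Ioi]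
  · exact fun x hx => (hderiv x hx).differentiableAt.differentiableWithinAt
  · intro x hx y hy hxy
    have hx' : 0 < x := hx
    rw [(hderiv x hx).deriv, (hderiv y hy).deriv]
    gcongr

/-- `A ↦ log(arctan(s(A)))` with `s(A) = ∑ᵢ A/(A+Dᵢ)` is strictly increasing
and concave on `(0,∞)`; hence the Yoshimori–Lahiri adjustment factor has
strictly increasing concave logarithm, as required by Condition A3. -/
theorem log_arctan_trace_increasing_concave
    (m : ℕ) (hm : 0 < m) (D : Fin m → ℝ) (hD : ∀ j, 0 < D j)
    (s : ℝ → ℝ) (hs : ∀ A, s A = ∑ j, A / (A + D j)) :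
    StrictMonoOn (fun A => Real.log (Real.arctan (s A))) (Set.Ioi 0) ∧
      ConcaveOn ℝ (Set.Ioi 0) (fun A => Real.log (Real.arctan (s A))) := by
  obtain rfl : s = fun A => ∑ j, A / (A + D j) := funext hs
  have : Nonempty (Fin m) := ⟨⟨0, hm⟩⟩
  have hpos : ∀ A ∈ Set.Ioi (0 : ℝ), 0 < ∑ j, A / (A + D j) := fun A hA =>
    Finset.sum_pos (fun j _ => div_pos hA (add_pos hA (hD j))) Finset.univ_nonempty
  constructor
  · intro A hA B hB hAB
    refine Real.log_lt_log (Real.arctan_pos.2 (hpos A hA)) (Real.arctan_strictMono ?_)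
    exact Finset.sum_lt_sum_of_nonempty Finset.univ_nonempty
      fun j _ => strictMonoOn_div_add_const (hD j) hA hB hAB
  · have hsum : ConcaveOn ℝ (Set.Ioi 0) (fun A : ℝ => ∑ j, A / (A + D j)) :=
      concaveOn_finset_sum _ (convex_Ioi 0) fun j _ => concaveOn_div_add_const (hD j)
    exact strictConcaveOn_log_Ioi.concaveOn.comp_of_mapsTo
      (concaveOn_arctan.comp_of_mapsTo hsum (Real.arctan_strictMono.monotone.monotoneOn _)
        fun A hA => (hpos A hA).le)
      Real.strictMonoOn_log.monotoneOn fun A hA => Real.arctan_pos.2 (hpos A hA)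
end
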